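/- Suppose f ∈ 𝒜* has special combinatorics. Then there is a universal constant κ₀ > 0 such that for any sufficiently small open cover 𝒰 of the Cantor set ω(c) (i.e. any open cover refining the nice cover 𝒴 associated to the nice interval Y witnessing the special combinatorics), the topological complexity function satisfies p(𝒰, n+1) ≥ κ₀·n for all n large enough. -/

import Mathlib

open Set Function MeasureTheory Filter Topology
open scoped Classical

noncomputable section

/-- Length (Lebesgue measure) of a set of reals. -/
def len (S : Set ℝ) : ℝ := (volume S).toReal

/-- A bounded open interval. -/
def IsOpenInterval (S : Set ℝ) : Prop := ∃ a b : ℝ, a < b ∧ S = Set.Ioo a b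

/-- The ω-limit set of a point under iteration of `f`. -/
def omegaLimitSet (f : ℝ → ℝ) (x : ℝ) : Set ℝ :=
  ⋂ N : ℕ, closure ((fun n => f^[n] x) '' {n : ℕ | N ≤ n})

/-- Unimodal maps of class 𝒜 with turning point `c`, which is non-flat of order `ℓ`:
continuous on `[0,1]`, strictly increasing on `[0,c]`, strictly decreasing on `[c,1]`,
`C³` outside `c` with non-vanishing derivative, and `|ψ⁻¹ ∘ f ∘ φ (x)| = |x|^ℓ`
near `0` for `C³` local diffeomorphisms `φ, ψ` with `φ 0 = c`, `ψ 0 = f c`. -/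
structure UnimodalA (f : ℝ → ℝ) (c ℓ : ℝ) : Prop where
  cont : ContinuousOn f (Set.Icc 0 1)
  maps : Set.MapsTo f (Set.Icc 0 1) (Set.Icc 0 1)
  c_mem : c ∈ Set.Ioo (0:ℝ) 1
  mono : StrictMonoOn f (Set.Icc 0 c)
  anti : StrictAntiOn f (Set.Icc c 1)
  smooth : ContDiffOn ℝ 3 f (Set.Icc 0 1 \ {c})
  deriv_ne : ∀ x ∈ Set.Icc 0 1 \ {c}, deriv f x ≠ 0
  ell_gt_one : 1 < ℓ
  nonflat : ∃ φ ψ : ℝ → ℝ, φ 0 = c ∧ ψ 0 = f c ∧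
    (∃ U ∈ 𝓝 (0:ℝ), ContDiffOn ℝ 3 φ U ∧ ContDiffOn ℝ 3 ψ U) ∧
    deriv φ 0 ≠ 0 ∧ deriv ψ 0 ≠ 0 ∧
    ∃ s : ℝ, |s| = 1 ∧ ∀ᶠ x in 𝓝 (0:ℝ), f (φ x) = ψ (s * |x| ^ ℓ)

/-- All periodic points of `f` in `[0,1]` are hyperbolic repelling. -/
def AllPeriodicHyperbolicRepelling (f : ℝ → ℝ) : Prop :=
  ∀ x ∈ Set.Icc (0:ℝ) 1, ∀ p : ℕ, 0 < p → f^[p] x = x → 1 < |deriv (f^[p]) x|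

/-- The class 𝒜₊ : maps in 𝒜 with all periodic points hyperbolic repelling. -/
def UnimodalAStar (f : ℝ → ℝ) (c ℓ : ℝ) : Prop :=
  UnimodalA f c ℓ ∧ AllPeriodicHyperbolicRepelling f

/-- A (minimal) metric attractor: a compact invariant set whose realm of attraction has
positive Lebesgue measure, while no proper compact invariant subset has this property. -/
def IsMetricAttractor (f : ℝ → ℝ) (X : Set ℝ) : Prop :=
  IsCompact X ∧ X ⊆ Set.Icc 0 1 ∧ f '' X ⊆ X ∧
  0 < volume {x ∈ Set.Icc (0:ℝ) 1 | omegaLimitSet f x ⊆ X} ∧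
  ∀ X' : Set ℝ, X' ⊂ X → IsCompact X' → f '' X' ⊆ X' →
    volume {x ∈ Set.Icc (0:ℝ) 1 | omegaLimitSet f x ⊆ X'} = 0

/-- A Cantor set: nonempty, compact, perfect, totally disconnected. -/
def IsCantorSet (X : Set ℝ) : Prop :=
  X.Nonempty ∧ IsCompact X ∧ Perfect X ∧ IsTotallyDisconnected X

/-- A nice interval: an open interval `T ⊆ [0,1]` such that the forward orbit of `∂T`
never enters `T`, and `T` contains no fixed point of `f`. -/
def IsNiceInterval (f : ℝ → ℝ) (T : Set ℝ) : Prop :=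
  IsOpenInterval T ∧ T ⊆ Set.Icc 0 1 ∧
  (∀ n : ℕ, ∀ x ∈ frontier T, f^[n] x ∉ T) ∧
  (∀ x ∈ T, f x ≠ x)

/-- A symmetric nice interval containing `c`: `f(∂T)` is a single point. -/
def IsSymmNice (f : ℝ → ℝ) (c : ℝ) (T : Set ℝ) : Prop :=
  IsNiceInterval f T ∧ c ∈ T ∧ ∃ y : ℝ, ∀ x ∈ frontier T, f x = y

/-- `D(T)`: the set of points entering `T` under some positive iterate. -/
def entryDomain (f : ℝ → ℝ) (T : Set ℝ) : Set ℝ :=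
  {x | ∃ k : ℕ, 1 ≤ k ∧ f^[k] x ∈ T}

/-- The return domain of `T` containing `x` (component of `D(T) ∩ T`). -/
def returnDomain (f : ℝ → ℝ) (T : Set ℝ) (x : ℝ) : Set ℝ :=
  connectedComponentIn (entryDomain f T ∩ T) x

/-- `U` is a return domain of `T`. -/
def IsReturnDomain (f : ℝ → ℝ) (T U : Set ℝ) : Prop :=
  ∃ x ∈ entryDomain f T ∩ T, U = returnDomain f T x

/-- `k` is the first return time of `x` to `T`. -/
def IsFirstReturnTime (f : ℝ → ℝ) (T : Set ℝ) (x : ℝ) (k : ℕ) : Prop :=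
  1 ≤ k ∧ f^[k] x ∈ T ∧ ∀ j : ℕ, 1 ≤ j → j < k → f^[j] x ∉ T

/-- `J` is a pull back of `V` by `f^k`, i.e. a connected component of `f^{-k}(V)`. -/
def IsPullbackBy (f : ℝ → ℝ) (V J : Set ℝ) (k : ℕ) : Prop :=
  ∃ x ∈ f^[k] ⁻¹' V, J = connectedComponentIn (f^[k] ⁻¹' V) x

/-- `J` is a child of `T` with transition time `k`: a unimodal pull back of `T`
containing `c`, i.e. `f^{k-1}` maps a neighborhood of `f(J)` diffeomorphically
(injectively) onto `T`. -/
def IsChildWithTime (f : ℝ → ℝ) (c : ℝ) (T J : Set ℝ) (k : ℕ) : Prop :=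
  1 ≤ k ∧ c ∈ J ∧ IsPullbackBy f T J k ∧
  ∃ W : Set ℝ, IsOpen W ∧ f '' J ⊆ W ∧ Set.InjOn (f^[k - 1]) W ∧ f^[k - 1] '' W = T

/-- `J` is a child of `T`. -/
def IsChild (f : ℝ → ℝ) (c : ℝ) (T J : Set ℝ) : Prop :=
  ∃ k : ℕ, IsChildWithTime f c T J k

/-- The number `ν(T)` of children of `T`. -/
def numChildren (f : ℝ → ℝ) (c : ℝ) (T : Set ℝ) : ℕ :=
  {J : Set ℝ | IsChild f c T J}.ncard

/-- The interval `J` is `τ`-well inside the interval `I`: both components of `I ∖ J`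
have length at least `τ·|J|`. -/
def WellInside (τ : ℝ) (J I : Set ℝ) : Prop :=
  ∃ a b a' b' : ℝ, a' ≤ a ∧ a < b ∧ b ≤ b' ∧ J = Set.Ioo a b ∧ I = Set.Ioo a' b' ∧
    τ * (b - a) ≤ a - a' ∧ τ * (b - a) ≤ b' - b

/-- A `τ`-nice interval: every return domain is `τ`-well inside it. -/
def IsTauNice (f : ℝ → ℝ) (τ : ℝ) (T : Set ℝ) : Prop :=
  ∀ x ∈ entryDomain f T ∩ T, WellInside τ (returnDomain f T x) T

/-- A `τ`-non-central-nice interval: every return domain, except possibly the one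
containing `c`, is `τ`-well inside it. -/
def IsNonCentralTauNice (f : ℝ → ℝ) (c : ℝ) (τ : ℝ) (T : Set ℝ) : Prop :=
  ∀ x ∈ entryDomain f T ∩ T, c ∉ returnDomain f T x →
    WellInside τ (returnDomain f T x) T

/-- `I` is a restrictive interval of period `s` for `f`. -/
def IsRenormInterval (f : ℝ → ℝ) (c : ℝ) (I : Set ℝ) (s : ℕ) : Prop :=
  (∃ a b : ℝ, a < b ∧ I = Set.Icc a b) ∧ c ∈ interior I ∧ 2 ≤ s ∧
  (∀ i j : ℕ, i < j → j < s → interior (f^[i] '' I) ∩ interior (f^[j] '' I) = ∅) ∧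
  f^[s] '' I ⊆ I ∧ f^[s] '' frontier I ⊆ frontier I

/-- `f` is renormalizable. -/
def Renormalizable (f : ℝ → ℝ) (c : ℝ) : Prop :=
  ∃ I s, IsRenormInterval f c I s

/-- `f` is infinitely renormalizable: restrictive intervals of arbitrarily large period. -/
def InfinitelyRenormalizable (f : ℝ → ℝ) (c : ℝ) : Prop :=
  ∀ N : ℕ, ∃ I s, N ≤ s ∧ IsRenormInterval f c I s

/-- `X` is a minimal set for `f`. -/
def IsMinimalOn (f : ℝ → ℝ) (X : Set ℝ) : Prop :=
  X.Nonempty ∧ IsClosed X ∧ f '' X ⊆ X ∧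
  ∀ x ∈ X, X ⊆ closure {y | ∃ n : ℕ, f^[n] x = y}

/-- The collection of connected components of `S` which intersect `ω(c)`. -/
def componentsMeeting (f : ℝ → ℝ) (c : ℝ) (S : Set ℝ) : Set (Set ℝ) :=
  {U | (∃ x ∈ S, U = connectedComponentIn S x) ∧ (U ∩ omegaLimitSet f c).Nonempty}

/-- The nice cover 𝒴 of `ω(c)` associated with a symmetric nice interval `Y`:
components of `Y ∪ D(Y)` meeting `ω(c)`. -/
def niceCover (f : ℝ → ℝ) (c : ℝ) (Y : Set ℝ) : Set (Set ℝ) :=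
  componentsMeeting f c (Y ∪ entryDomain f Y)

/-- `q(𝒴, n)`: the number of components of `f^{-n}(Y ∪ D(Y))` intersecting `ω(c)`. -/
def qCount (f : ℝ → ℝ) (c : ℝ) (Y : Set ℝ) (n : ℕ) : ℕ :=
  (componentsMeeting f c (f^[n] ⁻¹' (Y ∪ entryDomain f Y))).ncard

/-- `Y₋ₙ`: the component of `f^{-n}(Y ∪ D(Y))` containing `c`. -/
def criticalPullbackOfEntry (f : ℝ → ℝ) (c : ℝ) (Y : Set ℝ) (n : ℕ) : Set ℝ :=
  connectedComponentIn (f^[n] ⁻¹' (Y ∪ entryDomain f Y)) c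

/-- `𝒰` is an open cover of `X`. -/
def IsOpenCover (X : Set ℝ) (𝒰 : Set (Set ℝ)) : Prop :=
  (∀ U ∈ 𝒰, IsOpen U) ∧ X ⊆ ⋃₀ 𝒰

/-- The cover `⋁_{i=0}^{n-1} f^{-i} 𝒰`. -/
def coverJoin (f : ℝ → ℝ) (𝒰 : Set (Set ℝ)) (n : ℕ) : Set (Set ℝ) :=
  {V | ∃ U : Fin n → Set ℝ, (∀ i, U i ∈ 𝒰) ∧ V = ⋂ i : Fin n, f^[(i : ℕ)] ⁻¹' U i}

/-- The topological complexity function `p(𝒰, n) = N(⋁_{i=0}^{n-1} f^{-i} 𝒰)`: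
the minimal cardinality of a finite subcover of `X` from the joined cover. -/
def complexity (f : ℝ → ℝ) (X : Set ℝ) (𝒰 : Set (Set ℝ)) (n : ℕ) : ℕ :=
  sInf {m : ℕ | ∃ 𝒱 : Set (Set ℝ), 𝒱 ⊆ coverJoin f 𝒰 n ∧ 𝒱.Finite ∧
        X ⊆ ⋃₀ 𝒱 ∧ 𝒱.ncard = m}

/-- A maximal central cascade `T⁰ ⊃ T¹ ⊃ ⋯ ⊃ Tᵐ` with common first return time `s`. -/
def IsMaximalCentralCascade (f : ℝ → ℝ) (c : ℝ) (T : ℕ → Set ℝ) (m s : ℕ) : Prop :=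
  1 ≤ m ∧ 1 ≤ s ∧ (∀ i ≤ m, IsSymmNice f c (T i)) ∧
  (∀ i < m, T (i + 1) = returnDomain f (T i) c) ∧
  (∀ i < m, IsFirstReturnTime f (T i) c s) ∧ f^[s] c ∉ T m

/-- `Λ`: the union of the components of `I ∪ D(I)` which intersect `ω(c)`. -/
def LambdaSet (f : ℝ → ℝ) (c : ℝ) (I : Set ℝ) : Set ℝ :=
  {x | x ∈ I ∪ entryDomain f I ∧
       (connectedComponentIn (I ∪ entryDomain f I) x ∩ omegaLimitSet f c).Nonempty}

/-- `Λ(T)`: points which enter `T` while staying in `Λ` before doing so. -/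
def LambdaT (f : ℝ → ℝ) (c : ℝ) (I T : Set ℝ) : Set ℝ :=
  {x | ∃ k : ℕ, 1 ≤ k ∧ (∀ j < k, f^[j] x ∈ LambdaSet f c I) ∧ f^[k] x ∈ T}

/-- The fixed base interval `I`: a symmetric nice interval containing `c` such that
the associated `Λ` is compactly contained in `[f²(c), f(c)]`. -/
def GoodBase (f : ℝ → ℝ) (c : ℝ) (I : Set ℝ) : Prop :=
  IsSymmNice f c I ∧ closure (LambdaSet f c I) ⊆ Set.Ioo (f (f c)) (f c)

/-- `λ(Y'|Y)`: the supremum over diffeomorphisms `f^s : J → Y` of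
`|(f^s|J)^{-1}(Y')| / |J|`. -/
def lamRatio (f : ℝ → ℝ) (Y' Y : Set ℝ) : ℝ :=
  sSup {r : ℝ | ∃ (s : ℕ) (J : Set ℝ), IsOpenInterval J ∧
        Set.InjOn (f^[s]) J ∧ f^[s] '' J = Y ∧
        r = len (J ∩ f^[s] ⁻¹' Y') / len J}

/-- `ξ(Y'|Y) = 1 − λ(Y'|Y)`. -/
def xiRel (f : ℝ → ℝ) (Y' Y : Set ℝ) : ℝ := 1 - lamRatio f Y' Y

/-- The empty space `ξ(T) = ξ(Λ(T) ∩ T | T)`. -/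
def xiT (f : ℝ → ℝ) (c : ℝ) (I T : Set ℝ) : ℝ :=
  xiRel f (LambdaT f c I T ∩ T) T

/-- `Y_{-j}` in the chain of pull backs of `Y` along the orbit `c, f(c), …, fⁿ(c)`:
the component of `f^{-j}(Y)` containing `f^{n-j}(c)`. -/
def chainAt (f : ℝ → ℝ) (c : ℝ) (Y : Set ℝ) (n j : ℕ) : Set ℝ :=
  connectedComponentIn (f^[j] ⁻¹' Y) (f^[n - j] c)

/-- The set of transition times `s_j` occurring in the chain from `Y_{-n}` to `Y`:
gaps between consecutive critical positions in the chain. -/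
def essentialTimes (f : ℝ → ℝ) (c : ℝ) (Y : Set ℝ) (n : ℕ) : Set ℕ :=
  {s : ℕ | ∃ j j' : ℕ, j < j' ∧ j' ≤ n ∧ c ∈ chainAt f c Y n j ∧ c ∈ chainAt f c Y n j' ∧
    (∀ i : ℕ, j < i → i < j' → c ∉ chainAt f c Y n i) ∧ s = j' - j}

/-- The essential order `M_n(Y)`: the number of distinct transition times in the chain. -/
def essentialOrder (f : ℝ → ℝ) (c : ℝ) (Y : Set ℝ) (n : ℕ) : ℕ :=
  (essentialTimes f c Y n).ncard

/-- The first (largest) child of `T`. -/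
def IsFirstChild (f : ℝ → ℝ) (c : ℝ) (T J : Set ℝ) : Prop :=
  IsChild f c T J ∧ ∀ J', IsChild f c T J' → J' ⊆ J

/-- The second child of `T`: the second largest child. -/
def IsSecondChild (f : ℝ → ℝ) (c : ℝ) (T J : Set ℝ) : Prop :=
  IsChild f c T J ∧ ∃ J₁, IsFirstChild f c T J₁ ∧ J ⊂ J₁ ∧
    ∀ J', IsChild f c T J' → J' ≠ J₁ → J' ⊆ J

/-- The principal nest `Y = Y₀ ⊃ Y₁ ⊃ ⋯` starting from `Y`. -/
def principalNest (f : ℝ → ℝ) (c : ℝ) (Y : Set ℝ) : ℕ → Set ℝ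
  | 0 => Y
  | n + 1 => returnDomain f (principalNest f c Y n) c

/-- `f` has special combinatorics, witnessed by the symmetric nice interval `Y`:
`ω(c) ∋ c` is minimal and each annulus `Yₙ ∖ Yₙ₊₁` of the principal nest has
exactly one component intersecting `ω(c)`. -/
def SpecialCombinatorics (f : ℝ → ℝ) (c : ℝ) (Y : Set ℝ) : Prop :=
  c ∈ omegaLimitSet f c ∧ IsMinimalOn f (omegaLimitSet f c) ∧ IsSymmNice f c Y ∧
  ∀ n : ℕ, ∃! U : Set ℝ,
    U ∈ componentsMeeting f c (principalNest f c Y n \ principalNest f c Y (n + 1))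

/-- The adding machine map `f_α` on `Δ_α = Π i, {0, …, pᵢ − 1}`. -/
def addingMachine (p : ℕ → ℕ) (hp : ∀ i, 2 ≤ p i) (x : ∀ i, Fin (p i)) :
    ∀ i, Fin (p i) :=
  if h : ∃ l, (x l : ℕ) + 1 < p l then fun i =>
    if i < Nat.find h then ⟨0, by have := hp i; omega⟩
    else if hi : i = Nat.find h then
      ⟨(x i : ℕ) + 1, by rw [hi]; exact Nat.find_spec h⟩
    else x i
  else fun i => ⟨0, by have := hp i; omega⟩

/-- `f` restricted to `X` is topologically conjugate to an adding machine. -/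
def ConjugateToAddingMachine (f : ℝ → ℝ) (X : Set ℝ) : Prop :=
  ∃ (p : ℕ → ℕ) (hp : ∀ i, 2 ≤ p i) (φ : ℝ → ∀ i, Fin (p i)),
    ContinuousOn φ X ∧ Set.InjOn φ X ∧ φ '' X = Set.univ ∧
    ∀ x ∈ X, φ (f x) = addingMachine p hp (φ x)

/-- `f` restricted to `X` is equicontinuous (w.r.t. all iterates). -/
def EquicontinuousOnSet (f : ℝ → ℝ) (X : Set ℝ) : Prop :=
  ∀ ε > 0, ∃ δ > 0, ∀ x ∈ X, ∀ y ∈ X, |x - y| < δ →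
    ∀ n : ℕ, |f^[n] x - f^[n] y| < ε

section Words

variable {α β : Type*}

/-- The word of length `n` read off by the observable `g` along the `f`-orbit of `x`. -/
def orbitWord (f : α → α) (g : α → β) (n : ℕ) (x : α) : Fin n → β :=
  fun i => g (f^[i] x)

theorem orbitWord_eq_iff {f : α → α} {g : α → β} {n : ℕ} {x y : α} :
    orbitWord f g n x = orbitWord f g n y ↔ ∀ i < n, g (f^[i] x) = g (f^[i] y) :=
  ⟨fun h i hi => congrFun h ⟨i, hi⟩, fun h => funext fun i => h i i.2⟩

/-- If words of length `n` determine words of length `n + 1`, then they determine the whole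
itinerary. -/
theorem itinerary_eq_of_orbitWord_determines_succ {f : α → α} {g : α → β} {X : Set α}
    (hf : MapsTo f X X) {n : ℕ}
    (h : ∀ x ∈ X, ∀ y ∈ X, orbitWord f g n x = orbitWord f g n y →
      orbitWord f g (n + 1) x = orbitWord f g (n + 1) y) (i : ℕ) :
    ∀ x ∈ X, ∀ y ∈ X, orbitWord f g n x = orbitWord f g n y → g (f^[i] x) = g (f^[i] y) := by
  induction i with
  | zero =>
    intro x hx y hy hxy
    exact orbitWord_eq_iff.1 (h x hx y hy hxy) 0 n.succ_pos
  | succ i ih =>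
    intro x hx y hy hxy
    have h' := orbitWord_eq_iff.1 (h x hx y hy hxy)
    refine ih (f x) (hf hx) (f y) (hf hy) (orbitWord_eq_iff.2 fun j hj => ?_)
    exact h' (j + 1) (by omega)

/-- Morse–Hedlund: infinitely many itineraries force more than `n` words of length `n`. -/
theorem succ_le_encard_orbitWord {f : α → α} {g : α → β} {X : Set α} (hf : MapsTo f X X)
    (hinf : ((fun x (i : ℕ) => g (f^[i] x)) '' X).Infinite) (n : ℕ) :
    (n + 1 : ℕ∞) ≤ (orbitWord f g n '' X).encard := by
  induction n with
  | zero =>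
    have : X.Nonempty := hinf.nonempty.of_image
    simpa [Set.one_le_encard_iff_nonempty] using this
  | succ n ih =>
    let r : (Fin (n + 1) → β) → (Fin n → β) := fun w i => w i.castSucc
    have hr : r '' (orbitWord f g (n + 1) '' X) = orbitWord f g n '' X := by
      rw [image_image]
      rfl
    by_contra hlt
    have hfin : (orbitWord f g (n + 1) '' X).Finite :=
      Set.finite_of_encard_le_coe (k := n + 2) (le_of_lt (by
        refine (not_le.1 hlt).trans_le ?_
        push_cast
        rw [add_assoc]
        norm_num))
    have hle : (orbitWord f g (n + 1) '' X).encard ≤ (n + 1 : ℕ∞) := by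
      have := not_le.1 hlt
      exact Order.le_of_lt_add_one (by exact_mod_cast this)
    have heq : (r '' (orbitWord f g (n + 1) '' X)).encard
        = (orbitWord f g (n + 1) '' X).encard :=
      le_antisymm (encard_image_le _ _) (hle.trans (hr ▸ ih))
    have hinj := hfin.injOn_of_encard_image_eq heq
    have hdet := itinerary_eq_of_orbitWord_determines_succ (g := g) hf (n := n)
      fun x hx y hy hxy => hinj (mem_image_of_mem _ hx) (mem_image_of_mem _ hy) hxy
    have hfin' : (orbitWord f g n '' X).Finite := hr ▸ hfin.image r
    choose s hsX hs using fun w : orbitWord f g n '' X => w.2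
    have := hfin'.to_subtype
    refine hinf ((Set.finite_range fun w i => g (f^[i] (s w))).subset ?_)
    rintro _ ⟨x, hx, rfl⟩
    refine ⟨⟨orbitWord f g n x, mem_image_of_mem _ hx⟩, funext fun i => ?_⟩
    exact hdet i _ (hsX _) x hx (hs _)

end Words

/-- A unimodal map sends a segment into every order-connected set containing the images of its
endpoints and, if the turning point lies in the segment, the critical value. -/
theorem UnimodalA.image_uIcc_subset {f : ℝ → ℝ} {c ℓ : ℝ} (hf : UnimodalA f c ℓ) {C : Set ℝ}
    (hC : C.OrdConnected) {u v : ℝ} (hu : u ∈ Icc (0 : ℝ) 1) (hv : v ∈ Icc (0 : ℝ) 1)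
    (hfu : f u ∈ C) (hfv : f v ∈ C) (hfc : c ∈ uIcc u v → f c ∈ C) :
    f '' uIcc u v ⊆ C := by
  wlog huv : u ≤ v generalizing u v
  · rw [uIcc_comm]
    exact this hv hu hfv hfu (by rwa [uIcc_comm]) (le_of_not_ge huv)
  rw [uIcc_of_le huv] at *
  rintro _ ⟨w, ⟨huw, hwv⟩, rfl⟩
  have hc := hf.c_mem
  rcases le_total w c with hwc | hcw
  · have h1 : f u ≤ f w := hf.mono.monotoneOn ⟨hu.1, huw.trans hwc⟩ ⟨hu.1.trans huw, hwc⟩ huw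
    rcases le_total v c with hvc | hcv
    · exact hC.out hfu hfv ⟨h1,
        hf.mono.monotoneOn ⟨hu.1.trans huw, hwc⟩ ⟨hv.1, hvc⟩ hwv⟩
    · exact hC.out hfu (hfc ⟨huw.trans hwc, hcv⟩) ⟨h1,
        hf.mono.monotoneOn ⟨hu.1.trans huw, hwc⟩ ⟨hc.1.le, le_rfl⟩ hwc⟩
  · have h1 : f v ≤ f w := hf.anti.antitoneOn ⟨hcw, hwv.trans hv.2⟩ ⟨hcw.trans hwv, hv.2⟩ hwv
    rcases le_total c u with hcu | huc
    · exact hC.out hfv hfu ⟨h1,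
        hf.anti.antitoneOn ⟨hcu, hu.2⟩ ⟨hcw, hwv.trans hv.2⟩ huw⟩
    · exact hC.out hfv (hfc ⟨huc, hcw.trans hwv⟩) ⟨h1,
        hf.anti.antitoneOn ⟨le_rfl, hc.2.le⟩ ⟨hcw, hwv.trans hv.2⟩ hcw⟩

theorem UnimodalA.continuousOn_iterate {f : ℝ → ℝ} {c ℓ : ℝ} (hf : UnimodalA f c ℓ) (k : ℕ) :
    ContinuousOn f^[k] (Icc 0 1) :=
  hf.cont.iterate hf.maps k

/-- The part of niceness inherited by central return domains: `T ⊆ [0,1]` is an open connected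
neighbourhood of `c` whose boundary orbits avoid `T`. -/
structure IsCentralNice (f : ℝ → ℝ) (c : ℝ) (T : Set ℝ) : Prop where
  isOpen : IsOpen T
  isPreconnected : IsPreconnected T
  subset_Icc : T ⊆ Icc 0 1
  mem : c ∈ T
  frontier_notMem : ∀ z ∈ frontier T, ∀ n : ℕ, f^[n] z ∉ T

theorem IsSymmNice.isCentralNice {f : ℝ → ℝ} {c : ℝ} {T : Set ℝ} (h : IsSymmNice f c T) :
    IsCentralNice f c T := by
  obtain ⟨⟨⟨a, b, -, rfl⟩, hI, hfr, -⟩, hc, -⟩ := h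
  exact ⟨isOpen_Ioo, isPreconnected_Ioo, hI, hc, fun z hz n => hfr n z hz⟩

theorem mem_union_entryDomain_of_iterate {f : ℝ → ℝ} {T : Set ℝ} {x : ℝ} {k : ℕ}
    (h : f^[k] x ∈ T) : x ∈ T ∪ entryDomain f T := by
  rcases k.eq_zero_or_pos with rfl | hk
  · exact Or.inl h
  · exact Or.inr ⟨k, hk, h⟩

theorem mem_entryDomain_iff {f : ℝ → ℝ} {T : Set ℝ} {x : ℝ} :
    x ∈ entryDomain f T ↔ f x ∈ T ∪ entryDomain f T := by
  constructor
  · rintro ⟨k, hk, h⟩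
    obtain ⟨j, rfl⟩ := Nat.exists_eq_add_of_le' hk
    exact mem_union_entryDomain_of_iterate h
  · rintro (h | ⟨k, -, h⟩)
    · exact ⟨1, le_rfl, h⟩
    · exact ⟨k + 1, by omega, h⟩

/-- A connected subset of `T ∪ D(T)` that meets a nice interval `T` lies in `T`. -/
theorem IsCentralNice.subset_of_inter_nonempty {f : ℝ → ℝ} {c : ℝ} {T K : Set ℝ}
    (h : IsCentralNice f c T) (hK : IsPreconnected K) (hKT : K ⊆ T ∪ entryDomain f T)
    (hne : (K ∩ T).Nonempty) : K ⊆ T := by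
  refine hK.subset_left_of_subset_union h.isOpen isClosed_closure.isOpen_compl
    (disjoint_compl_right_iff_subset.2 subset_closure) (fun z hzK => ?_) hne
  by_contra hz
  rw [mem_union, mem_compl_iff, not_or, not_not] at hz
  have hzfr : z ∈ frontier T := h.isOpen.frontier_eq ▸ ⟨hz.2, hz.1⟩
  rcases hKT hzK with hzT | ⟨k, -, hk⟩
  · exact hz.1 hzT
  · exact h.frontier_notMem z hzfr k hk

theorem IsCentralNice.isOpen_entryDomain_inter {f : ℝ → ℝ} {c ℓ : ℝ} (hf : UnimodalA f c ℓ)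
    {T : Set ℝ} (h : IsCentralNice f c T) : IsOpen (entryDomain f T ∩ T) := by
  have : entryDomain f T ∩ T = ⋃ k : ℕ, ⋃ _ : 1 ≤ k, T ∩ f^[k] ⁻¹' T := by
    ext x
    simp only [entryDomain, mem_inter_iff, mem_ofPred_eq, mem_iUnion, mem_preimage, exists_prop]
    grind
  rw [this]
  exact isOpen_iUnion fun k => isOpen_iUnion fun _ =>
    ((hf.continuousOn_iterate k).mono h.subset_Icc).isOpen_inter_preimage h.isOpen h.isOpen

theorem IsCentralNice.returnDomain {f : ℝ → ℝ} {c ℓ : ℝ} (hf : UnimodalA f c ℓ) {T : Set ℝ}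
    (h : IsCentralNice f c T) (hc : c ∈ entryDomain f T) :
    IsCentralNice f c (returnDomain f T c) := by
  have hsub : _root_.returnDomain f T c ⊆ entryDomain f T ∩ T := connectedComponentIn_subset _ _
  have hmem : c ∈ _root_.returnDomain f T c := mem_connectedComponentIn ⟨hc, h.mem⟩
  have hopen : IsOpen (_root_.returnDomain f T c) :=
    (h.isOpen_entryDomain_inter hf).connectedComponentIn
  refine ⟨hopen, isPreconnected_connectedComponentIn,
    hsub.trans (inter_subset_right.trans h.subset_Icc), hmem, fun z hz n hn => ?_⟩
  rw [hopen.frontier_eq] at hz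
  have hzD : z ∉ entryDomain f T ∩ T := by
    intro hzD
    have hpre : IsPreconnected (insert z (_root_.returnDomain f T c)) :=
      isPreconnected_connectedComponentIn.subset_closure (subset_insert _ _)
        (insert_subset hz.1 subset_closure)
    exact hz.2 (hpre.subset_connectedComponentIn (mem_insert_of_mem _ hmem)
      (insert_subset hzD hsub) (mem_insert _ _))
  rcases n.eq_zero_or_pos with rfl | hpos
  · exact hz.2 hn
  have hzT : z ∉ T := fun hzT => hzD ⟨⟨n, hpos, (hsub hn).2⟩, hzT⟩
  have hzfr : z ∈ frontier T := by
    rw [h.isOpen.frontier_eq]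
    exact ⟨closure_mono (hsub.trans inter_subset_right) hz.1, hzT⟩
  exact h.frontier_notMem z hzfr n (hsub hn).2

/-- Every orbit in a minimal set enters each open set meeting it. -/
theorem IsMinimalOn.exists_iterate_mem {f : ℝ → ℝ} {X : Set ℝ} (hX : IsMinimalOn f X) {T : Set ℝ}
    (hT : IsOpen T) {c : ℝ} (hcX : c ∈ X) (hcT : c ∈ T) {x : ℝ} (hx : x ∈ X) :
    ∃ k : ℕ, f^[k] x ∈ T := by
  obtain ⟨_, hyT, k, rfl⟩ := mem_closure_iff.1 (hX.2.2.2 x hx hcX) T hT hcT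
  exact ⟨k, hyT⟩

theorem IsMinimalOn.mapsTo {f : ℝ → ℝ} {X : Set ℝ} (hX : IsMinimalOn f X) : MapsTo f X X :=
  mapsTo_iff_image_subset.2 hX.2.2.1

theorem isCentralNice_principalNest {f : ℝ → ℝ} {c ℓ : ℝ} (hf : UnimodalA f c ℓ) {Y : Set ℝ}
    (hY : SpecialCombinatorics f c Y) (n : ℕ) : IsCentralNice f c (principalNest f c Y n) := by
  induction n with
  | zero => exact hY.2.2.1.isCentralNice
  | succ n ih =>
    refine ih.returnDomain hf (mem_entryDomain_iff.2 ?_)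
    obtain ⟨k, hk⟩ := hY.2.1.exists_iterate_mem ih.isOpen hY.1 ih.mem (hY.2.1.mapsTo hY.1)
    exact mem_union_entryDomain_of_iterate hk

theorem principalNest_succ_subset {f : ℝ → ℝ} {c : ℝ} {Y : Set ℝ} (n : ℕ) :
    principalNest f c Y (n + 1) ⊆
      entryDomain f (principalNest f c Y n) ∩ principalNest f c Y n :=
  connectedComponentIn_subset _ _

theorem principalNest_antitone {f : ℝ → ℝ} {c : ℝ} {Y : Set ℝ} :
    Antitone (principalNest f c Y) :=
  antitone_nat_of_succ_le fun n => (principalNest_succ_subset n).trans inter_subset_right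

theorem omegaLimitSet_subset_Icc {f : ℝ → ℝ} {c ℓ : ℝ} (hf : UnimodalA f c ℓ) :
    omegaLimitSet f c ⊆ Icc 0 1 := by
  refine (iInter_subset _ 0).trans (closure_minimal ?_ isClosed_Icc)
  rintro _ ⟨n, -, rfl⟩
  exact hf.maps.iterate n (Ioo_subset_Icc_self hf.c_mem)

theorem isCompact_omegaLimitSet {f : ℝ → ℝ} {c ℓ : ℝ} (hf : UnimodalA f c ℓ) :
    IsCompact (omegaLimitSet f c) :=
  isCompact_Icc.of_isClosed_subset (isClosed_iInter fun _ => isClosed_closure)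
    (omegaLimitSet_subset_Icc hf)

/-- `x` and `y` have the same itinerary with respect to the components of `Y ∪ D(Y)`. -/
def SameItinerary (f : ℝ → ℝ) (Y : Set ℝ) (x y : ℝ) : Prop :=
  ∀ i : ℕ, connectedComponentIn (Y ∪ entryDomain f Y) (f^[i] x) =
    connectedComponentIn (Y ∪ entryDomain f Y) (f^[i] y)

theorem SameItinerary.symm {f : ℝ → ℝ} {Y : Set ℝ} {x y : ℝ} (h : SameItinerary f Y x y) :
    SameItinerary f Y y x :=
  fun i => (h i).symm

theorem SameItinerary.map {f : ℝ → ℝ} {Y : Set ℝ} {x y : ℝ} (h : SameItinerary f Y x y) :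
    SameItinerary f Y (f x) (f y) :=
  fun i => h (i + 1)

/-- Two points of `ω(c)` in the same annulus of the principal nest lie on the same side of `c`. -/
theorem SpecialCombinatorics.notMem_uIcc {f : ℝ → ℝ} {c ℓ : ℝ} (hf : UnimodalA f c ℓ) {Y : Set ℝ}
    (hY : SpecialCombinatorics f c Y) {n : ℕ} {x y : ℝ} (hx : x ∈ omegaLimitSet f c)
    (hy : y ∈ omegaLimitSet f c) (hxn : x ∈ principalNest f c Y n \ principalNest f c Y (n + 1))
    (hyn : y ∈ principalNest f c Y n \ principalNest f c Y (n + 1)) : c ∉ uIcc x y := by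
  intro hc
  have heq := (hY.2.2.2 n).unique
    ⟨⟨x, hxn, rfl⟩, x, mem_connectedComponentIn hxn, hx⟩
    ⟨⟨y, hyn, rfl⟩, y, mem_connectedComponentIn hyn, hy⟩
  have hymem : y ∈ connectedComponentIn
      (principalNest f c Y n \ principalNest f c Y (n + 1)) x :=
    heq ▸ mem_connectedComponentIn hyn
  have hcmem := isPreconnected_connectedComponentIn.ordConnected.uIcc_subset
    (mem_connectedComponentIn hxn) hymem hc
  exact (connectedComponentIn_subset _ _ hcmem).2 (isCentralNice_principalNest hf hY (n + 1)).mem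

/-- If segments between equivalent points stay in `Yₙ ∪ D(Yₙ)`, then `Yₙ₊₁ ∩ ω(c)` is a union of
itinerary classes, each spanning a segment in `Yₙ₊₁`. -/
theorem uIcc_subset_principalNest_succ {f : ℝ → ℝ} {c ℓ : ℝ} (hf : UnimodalA f c ℓ) {Y : Set ℝ}
    (hY : SpecialCombinatorics f c Y) {n : ℕ}
    (hn : ∀ x ∈ omegaLimitSet f c, ∀ y ∈ omegaLimitSet f c, SameItinerary f Y x y →
      uIcc x y ⊆ principalNest f c Y n ∪ entryDomain f (principalNest f c Y n))
    {x y : ℝ} (hx : x ∈ omegaLimitSet f c) (hy : y ∈ omegaLimitSet f c)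
    (hxy : SameItinerary f Y x y) (hxn : x ∈ principalNest f c Y (n + 1)) :
    uIcc x y ⊆ principalNest f c Y (n + 1) := by
  have hT := isCentralNice_principalNest hf hY n
  have hT' := isCentralNice_principalNest hf hY (n + 1)
  have hsub := principalNest_succ_subset (f := f) (c := c) (Y := Y) n
  have hmaps := hY.2.1.mapsTo
  have hseg := hn x hx y hy hxy
  set T := principalNest f c Y n
  have hsegT : uIcc x y ⊆ T :=
    hT.subset_of_inter_nonempty isPreconnected_uIcc hseg ⟨x, left_mem_uIcc, (hsub hxn).2⟩
  have hsegf := hn _ (hmaps hx) _ (hmaps hy) hxy.map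
  have hfx : f x ∈ T ∪ entryDomain f T := hsegf left_mem_uIcc
  set C := connectedComponentIn (T ∪ entryDomain f T) (f x)
  have hfyC : f y ∈ C :=
    isPreconnected_uIcc.subset_connectedComponentIn left_mem_uIcc hsegf right_mem_uIcc
  have himC : f '' principalNest f c Y (n + 1) ⊆ C := by
    refine (hT'.isPreconnected.image f (hf.cont.mono hT'.subset_Icc)).subset_connectedComponentIn
      (mem_image_of_mem f hxn) ?_
    rintro _ ⟨w, hw, rfl⟩
    exact mem_entryDomain_iff.1 (hsub hw).1
  have hsegC := hf.image_uIcc_subset isPreconnected_connectedComponentIn.ordConnected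
    (omegaLimitSet_subset_Icc hf hx) (omegaLimitSet_subset_Icc hf hy)
    (mem_connectedComponentIn hfx) hfyC fun _ => himC (mem_image_of_mem f hT'.mem)
  have hsegD : uIcc x y ⊆ entryDomain f T ∩ T := fun w hw =>
    ⟨mem_entryDomain_iff.2 (connectedComponentIn_subset _ _ (hsegC (mem_image_of_mem f hw))),
      hsegT hw⟩
  have hcx : principalNest f c Y (n + 1) = connectedComponentIn (entryDomain f T ∩ T) x :=
    connectedComponentIn_eq hxn
  rw [hcx]
  exact isPreconnected_uIcc.subset_connectedComponentIn left_mem_uIcc hsegD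

/-- Segments spanned by points of `ω(c)` with equal itineraries stay in `Yₙ ∪ D(Yₙ)`. -/
theorem uIcc_subset_union_entryDomain {f : ℝ → ℝ} {c ℓ : ℝ} (hf : UnimodalA f c ℓ) {Y : Set ℝ}
    (hY : SpecialCombinatorics f c Y) (n : ℕ) :
    ∀ x ∈ omegaLimitSet f c, ∀ y ∈ omegaLimitSet f c, SameItinerary f Y x y →
      uIcc x y ⊆ principalNest f c Y n ∪ entryDomain f (principalNest f c Y n) := by
  have hmin := hY.2.1
  induction n with
  | zero =>
    have hmem : ∀ x ∈ omegaLimitSet f c, x ∈ Y ∪ entryDomain f Y := fun x hx => by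
      have hN := isCentralNice_principalNest hf hY 0
      obtain ⟨k, hk⟩ := hmin.exists_iterate_mem hN.isOpen hY.1 hN.mem hx
      exact mem_union_entryDomain_of_iterate hk
    intro x hx y hy hxy
    have hy' : y ∈ connectedComponentIn (Y ∪ entryDomain f Y) x :=
      (hxy 0).symm ▸ mem_connectedComponentIn (hmem y hy)
    exact (isPreconnected_connectedComponentIn.ordConnected.uIcc_subset
      (mem_connectedComponentIn (hmem x hx)) hy').trans (connectedComponentIn_subset _ _)
  | succ n ih =>
    have hT := isCentralNice_principalNest hf hY n
    have hT' := isCentralNice_principalNest hf hY (n + 1)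
    have key : ∀ m : ℕ, ∀ x ∈ omegaLimitSet f c, ∀ y ∈ omegaLimitSet f c,
        SameItinerary f Y x y → f^[m] x ∈ principalNest f c Y (n + 1) →
        uIcc x y ⊆ principalNest f c Y (n + 1) ∪
          entryDomain f (principalNest f c Y (n + 1)) := by
      intro m
      induction m with
      | zero =>
        intro x hx y hy hxy hm
        exact (uIcc_subset_principalNest_succ hf hY ih hx hy hxy hm).trans subset_union_left
      | succ m ihm =>
        intro x hx y hy hxy hm
        by_cases hxn : x ∈ principalNest f c Y (n + 1)
        · exact (uIcc_subset_principalNest_succ hf hY ih hx hy hxy hxn).trans subset_union_left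
        have hyn : y ∉ principalNest f c Y (n + 1) := fun hyn =>
          hxn (uIcc_subset_principalNest_succ hf hY ih hy hx hxy.symm hyn right_mem_uIcc)
        have hc : c ∉ uIcc x y := by
          intro hc
          have hseg := hT.subset_of_inter_nonempty isPreconnected_uIcc (ih x hx y hy hxy)
            ⟨c, hc, hT.mem⟩
          exact hY.notMem_uIcc hf hx hy ⟨hseg left_mem_uIcc, hxn⟩ ⟨hseg right_mem_uIcc, hyn⟩ hc
        have hsegf := ihm _ (hmin.mapsTo hx) _ (hmin.mapsTo hy) hxy.map hm
        have him := hf.image_uIcc_subset (ordConnected_uIcc (a := f x) (b := f y))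
          (omegaLimitSet_subset_Icc hf hx) (omegaLimitSet_subset_Icc hf hy)
          left_mem_uIcc right_mem_uIcc fun h => (hc h).elim
        exact fun w hw => Or.inr (mem_entryDomain_iff.2 (hsegf (him (mem_image_of_mem f hw))))
    intro x hx y hy hxy
    obtain ⟨m, hm⟩ := hmin.exists_iterate_mem hT'.isOpen hY.1 hT'.mem hx
    exact key m x hx y hy hxy hm

/-- Under special combinatorics, `ω(c)` carries infinitely many itineraries with respect to the
components of `Y ∪ D(Y)`. -/
theorem SpecialCombinatorics.infinite_itineraries {f : ℝ → ℝ} {c ℓ : ℝ} (hf : UnimodalA f c ℓ)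
    {Y : Set ℝ} (hY : SpecialCombinatorics f c Y) :
    ((fun x (i : ℕ) => connectedComponentIn (Y ∪ entryDomain f Y) (f^[i] x)) ''
      omegaLimitSet f c).Infinite := by
  have hex : ∀ n, ∃ z ∈ omegaLimitSet f c,
      z ∈ principalNest f c Y n \ principalNest f c Y (n + 1) := by
    intro n
    obtain ⟨U, ⟨⟨x, -, rfl⟩, z, hzU, hz⟩, -⟩ := hY.2.2.2 n
    exact ⟨z, hz, connectedComponentIn_subset _ _ hzU⟩
  choose z hzω hz using hex
  have hne : ∀ m n, n < m → ¬ SameItinerary f Y (z m) (z n) := by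
    intro m n hnm h
    have hm : z m ∈ principalNest f c Y (n + 1) := principalNest_antitone hnm (hz m).1
    exact (hz n).2 (uIcc_subset_principalNest_succ hf hY (uIcc_subset_union_entryDomain hf hY n)
      (hzω m) (hzω n) h hm right_mem_uIcc)
  refine Set.infinite_of_injective_forall_mem
    (f := fun n (i : ℕ) => connectedComponentIn (Y ∪ entryDomain f Y) (f^[i] (z n)))
    (fun m n h => ?_) fun n => mem_image_of_mem _ (hzω n)
  rcases lt_trichotomy m n with hlt | rfl | hlt
  · exact (hne n m hlt fun i => (congrFun h i).symm).elim
  · rfl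
  · exact (hne m n hlt fun i => congrFun h i).elim

/-- The joined cover of a compact invariant set has a finite subcover. -/
theorem exists_finite_subcover_coverJoin {f : ℝ → ℝ} {X : Set ℝ} (hX : IsCompact X)
    (hf : ∀ k : ℕ, ContinuousOn f^[k] X) (hmaps : MapsTo f X X) {𝒰 : Set (Set ℝ)}
    (h𝒰 : IsOpenCover X 𝒰) (n : ℕ) :
    ∃ 𝒱 : Set (Set ℝ), 𝒱 ⊆ coverJoin f 𝒰 n ∧ 𝒱.Finite ∧ X ⊆ ⋃₀ 𝒱 := by
  have hex : ∀ x ∈ X, ∃ V ∈ coverJoin f 𝒰 n, V ∈ 𝓝[X] x := by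
    intro x hx
    choose U hU hxU using fun i : Fin n => h𝒰.2 (hmaps.iterate i hx)
    refine ⟨_, ⟨U, hU, rfl⟩, Filter.iInter_mem.2 fun i => ?_⟩
    exact (hf i x hx) ((h𝒰.1 _ (hU i)).mem_nhds (hxU i))
  choose! V hV hVx using hex
  obtain ⟨t, ht, hcov⟩ := hX.elim_nhdsWithin_subcover V hVx
  refine ⟨V '' t, ?_, t.finite_toSet.image V, fun x hx => ?_⟩
  · rintro _ ⟨x, hx, rfl⟩
    exact hV x (ht x hx)
  · obtain ⟨y, hy, hxy⟩ := mem_iUnion₂.1 (hcov hx)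
    exact ⟨V y, mem_image_of_mem V hy, hxy⟩

/-- If `𝒰` refines the components of `S`, a cover of `X` by members of the joined cover has at
least as many elements as there are words read off from the components of `S`. -/
theorem encard_orbitWord_le_of_cover {f : ℝ → ℝ} {X S : Set ℝ} {𝒰 𝒱 : Set (Set ℝ)} {n : ℕ}
    (h𝒰 : ∀ U ∈ 𝒰, ∃ x, U ⊆ connectedComponentIn S x) (h𝒱 : 𝒱 ⊆ coverJoin f 𝒰 n)
    (hcov : X ⊆ ⋃₀ 𝒱) :
    (orbitWord f (connectedComponentIn S) n '' X).encard ≤ 𝒱.encard := by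
  have hconst : ∀ V ∈ 𝒱, ∃ w, ∀ x ∈ V, orbitWord f (connectedComponentIn S) n x = w := by
    intro V hV
    obtain ⟨U, hU, rfl⟩ := h𝒱 hV
    choose p hp using fun i => h𝒰 (U i) (hU i)
    refine ⟨fun i => connectedComponentIn S (p i), fun x hx => funext fun i => ?_⟩
    exact (connectedComponentIn_eq (hp i (mem_iInter.1 hx i))).symm
  choose! w hw using hconst
  refine le_trans (encard_le_encard ?_) (encard_image_le w 𝒱)
  rintro _ ⟨x, hx, rfl⟩
  obtain ⟨V, hV, hxV⟩ := hcov hx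
  exact ⟨V, hV, (hw V hV x hxV).symm⟩

/-- Corollary 5.6: if `f ∈ 𝒜₊` has special combinatorics (witnessed by `Y`), then for
any open cover `𝒰` of `ω(c)` refining the associated nice cover `𝒴`, the complexity
function satisfies `p(𝒰, n+1) ≥ κ₀ n` for all large `n`, with `κ₀ > 0` universal. -/
theorem special_combinatorics_complexity_lower_bound :
    ∃ κ₀ > 0, ∀ f : ℝ → ℝ, ∀ c ℓ : ℝ, UnimodalAStar f c ℓ →
      ∀ Y : Set ℝ, SpecialCombinatorics f c Y →
      ∀ 𝒰 : Set (Set ℝ), IsOpenCover (omegaLimitSet f c) 𝒰 →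
        (∀ U ∈ 𝒰, ∃ V ∈ niceCover f c Y, U ⊆ V) →
        ∃ N : ℕ, ∀ n : ℕ, N ≤ n →
          κ₀ * (n : ℝ) ≤ (complexity f (omegaLimitSet f c) 𝒰 (n + 1) : ℝ) := by
  refine ⟨1, one_pos, fun f c ℓ hf Y hY 𝒰 h𝒰 href => ⟨0, fun n _ => ?_⟩⟩
  have hmaps := hY.2.1.mapsTo
  obtain ⟨𝒲, h𝒲, hfin, hcov⟩ := exists_finite_subcover_coverJoin (isCompact_omegaLimitSet hf.1)
    (fun k => (hf.1.continuousOn_iterate k).mono (omegaLimitSet_subset_Icc hf.1)) hmaps h𝒰 (n + 1)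
  obtain ⟨𝒱, h𝒱, hfin𝒱, hcov𝒱, hcard⟩ : complexity f (omegaLimitSet f c) 𝒰 (n + 1) ∈ _ :=
    Nat.sInf_mem ⟨_, 𝒲, h𝒲, hfin, hcov, rfl⟩
  have hwords := (succ_le_encard_orbitWord hmaps (hY.infinite_itineraries hf.1) (n + 1)).trans
    (encard_orbitWord_le_of_cover (S := Y ∪ entryDomain f Y) (fun U hU => by
      obtain ⟨_, ⟨⟨x, -, rfl⟩, -⟩, hUV⟩ := href U hU
      exact ⟨x, hUV⟩) h𝒱 hcov𝒱)
  rw [← hfin𝒱.cast_ncard_eq, hcard] at hwords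
  have hle : n + 1 + 1 ≤ complexity f (omegaLimitSet f c) 𝒰 (n + 1) := by exact_mod_cast hwords
  rw [one_mul]
  exact_mod_cast (by omega : n ≤ _)
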